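/- Let ℓ be a prime with ℓ ≡ 1 (mod 4) and let p ≠ ℓ be a prime with p ≡ 3 (mod 4). Assume the order m of the image of p in the group 𝔽_ℓ^×/{±1} is odd. Then for q = p^n, the curve H_ℓ is maximal over 𝔽_{q²} if and only if n is an odd multiple of m. -/

import Mathlib

open Polynomial

/-- Number of affine points (x,y) ∈ F × F with y² = φ_d(x), where φ_d is the
d-th Chebyshev (Dickson first kind, parameter 1) polynomial over F. -/
noncomputable def chebAffineCount (F : Type) [Field F] (d : ℕ) : ℕ :=
  Nat.card {xy : F × F // xy.2 ^ 2 = (dickson 1 (1 : F) d).eval xy.1}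

/-- The hyperelliptic curve H_d : y² = φ_d(x) is maximal over the field with q² elements:
its affine point count attains q² + (d-1)q (Hasse–Weil bound minus the point at infinity). -/
def chebMaximal (d q : ℕ) : Prop :=
  ∀ (F : Type) [Field F] [Fintype F], Fintype.card F = q ^ 2 →
    chebAffineCount F d = q ^ 2 + (d - 1) * q

section part1
set_option linter.unusedSectionVars false
set_option linter.style.haveILetI false
variable {F : Type} [Field F] [Fintype F] [DecidableEq F]

lemma sqrts_sum (hF : ringChar F ≠ 2) (a : F) :
    ∑ y : F, (if y ^ 2 = a then (1 : ℤ) else 0) = quadraticChar F a + 1 := by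
  rw [← quadraticChar_card_sqrts hF a, Finset.sum_boole]
  simp

lemma cheb_count (hF : ringChar F ≠ 2) (d : ℕ) :
    (chebAffineCount F d : ℤ) = Fintype.card F +
      ∑ x : F, quadraticChar F ((dickson 1 (1 : F) d).eval x) := by
  unfold chebAffineCount
  rw [Nat.card_eq_fintype_card, Fintype.card_subtype]
  have : ((Finset.univ.filter (fun xy : F × F => xy.2 ^ 2 = (dickson 1 (1 : F) d).eval xy.1)).card : ℤ)
      = ∑ x : F, ∑ y : F, (if y ^ 2 = (dickson 1 (1 : F) d).eval x then (1 : ℤ) else 0) := by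
    rw [← Fintype.sum_prod_type' (f := fun x y : F => (if y ^ 2 = (dickson 1 (1 : F) d).eval x then (1 : ℤ) else 0)),
      Finset.sum_boole]
  rw [this]
  simp_rw [sqrts_sum hF]
  rw [Finset.sum_add_distrib]
  simp
  ring

lemma sum_add_inv (hF : ringChar F ≠ 2) (g : F → ℤ) :
    ∑ t : F, (if t = 0 then 0 else g (t + t⁻¹)) =
      ∑ x : F, g x * (quadraticChar F (x ^ 2 - 4) + 1) := by
  have h2 : (2 : F) ≠ 0 := Ring.two_ne_zero hF
  have key : ∀ x : F, ∑ t : F, (if t ≠ 0 ∧ t + t⁻¹ = x then (1 : ℤ) else 0) =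
      quadraticChar F (x ^ 2 - 4) + 1 := by
    intro x
    rw [← sqrts_sum hF]
    have e : Function.Bijective (fun t : F => 2 * t - x) := by
      refine Finite.injective_iff_bijective.mp ?_
      intro a b hab
      have : 2 * a = 2 * b := by linear_combination hab
      exact mul_left_cancel₀ h2 this
    refine Fintype.sum_bijective _ e _ _ ?_
    intro t
    congr 1
    apply propext
    constructor
    · rintro ⟨h0, h⟩
      have : t * t + 1 = x * t := by rw [← h]; field_simp
      linear_combination 4 * this
    · intro h
      have h4 : (4 : F) ≠ 0 := by
        have : (4 : F) = 2 * 2 := by norm_num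
        rw [this]; exact mul_ne_zero h2 h2
      have h1 : t * t + 1 = x * t := by
        apply mul_left_cancel₀ h4
        linear_combination h
      have h0 : t ≠ 0 := by
        rintro rfl
        simp at h1
      refine ⟨h0, ?_⟩
      field_simp
      linear_combination h1
  calc ∑ t : F, (if t = 0 then 0 else g (t + t⁻¹))
      = ∑ t : F, ∑ x : F, g x * (if t ≠ 0 ∧ t + t⁻¹ = x then (1 : ℤ) else 0) := by
        refine Finset.sum_congr rfl fun t _ => ?_
        by_cases h : t = 0
        · simp [h]
        · simp [h]
    _ = _ := by
        rw [Finset.sum_comm]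
        refine Finset.sum_congr rfl fun x _ => ?_
        rw [← Finset.mul_sum, key]

local notation "ACF" => AlgebraicClosure F

/-- elements `t + t⁻¹` with `t ^ N = 1` in the algebraic closure -/
def torus (F : Type) [Field F] (N : ℕ) (x : F) : Prop :=
  ∃ t : AlgebraicClosure F, t ^ N = 1 ∧ algebraMap F (AlgebraicClosure F) x = t + t⁻¹

lemma dick_map (x : F) (t : ACF) (ht : t ≠ 0) (hx : algebraMap F ACF x = t + t⁻¹) (k : ℕ) :
    algebraMap F ACF ((dickson 1 (1 : F) k).eval x) = t ^ k + (t ^ k)⁻¹ := by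
  have := dickson_one_one_eval_add_inv t t⁻¹ (mul_inv_cancel₀ ht) k
  rw [← inv_pow, ← this, ← hx, ← map_one (algebraMap F ACF), ← map_dickson, eval_map_algebraMap,
    aeval_algebraMap_apply]
  simp

lemma torus_ne {N : ℕ} (hN : 0 < N) {t : ACF} (ht : t ^ N = 1) : t ≠ 0 := by
  rintro rfl
  simp [hN.ne'] at ht

lemma torus_maps {N : ℕ} (hN : 0 < N) (k : ℕ) (x : F) (h : torus F N x) :
    torus F N ((dickson 1 (1 : F) k).eval x) := by
  obtain ⟨t, ht, hx⟩ := h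
  exact ⟨t ^ k, by rw [← pow_mul, mul_comm, pow_mul, ht, one_pow],
    dick_map x t (torus_ne hN ht) hx k⟩

lemma pow_of_modEq {N : ℕ} {t : ACF} (ht : t ^ N = 1) {a : ℕ} (h : a ≡ 1 [MOD N]) : t ^ a = t := by
  rw [pow_eq_pow_mod a ht, h, ← pow_eq_pow_mod 1 ht, pow_one]

lemma torus_inv {N : ℕ} (hN : 0 < N) (k l : ℕ) (hkl : k * l ≡ 1 [MOD N]) (x : F)
    (h : torus F N x) :
    (dickson 1 (1 : F) k).eval ((dickson 1 (1 : F) l).eval x) = x := by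
  obtain ⟨t, ht, hx⟩ := h
  rw [← eval_comp, ← dickson_one_one_mul]
  apply (algebraMap F ACF).injective
  rw [dick_map x t (torus_ne hN ht) hx, hx]
  have : t ^ (k * l) = t := pow_of_modEq ht hkl
  rw [this]

lemma exists_t (x : F) : ∃ t : ACF, t ≠ 0 ∧ algebraMap F ACF x = t + t⁻¹ := by
  have hd : (X ^ 2 - C (algebraMap F ACF x) * X + C 1 : ACF[X]).degree = 2 := by
    compute_degree!
  obtain ⟨t, ht⟩ := IsAlgClosed.exists_root (X ^ 2 - C (algebraMap F ACF x) * X + C 1 : ACF[X])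
    (by rw [hd]; norm_num)
  simp at ht
  have h0 : t ≠ 0 := by
    rintro rfl
    simp at ht
  refine ⟨t, h0, ?_⟩
  field_simp
  linear_combination -ht

lemma t_frob (x : F) (t : ACF) (h0 : t ≠ 0) (hx : algebraMap F ACF x = t + t⁻¹) :
    t ^ (Fintype.card F) = t ∨ t ^ (Fintype.card F + 1) = 1 := by
  have h1 : (algebraMap F ACF x) ^ (Fintype.card F) = algebraMap F ACF x := by
    rw [← map_pow, FiniteField.pow_card]
  have hfr : (t + t⁻¹) ^ (Fintype.card F) = t ^ (Fintype.card F) + t⁻¹ ^ (Fintype.card F) := by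
    obtain ⟨p, n, hp, hc⟩ := FiniteField.card' F
    haveI : Fact p.Prime := ⟨hc.1⟩
    rw [hc.2]
    haveI := hp
    haveI : CharP ACF p := charP_of_injective_algebraMap (algebraMap F ACF).injective p
    exact add_pow_char_pow ..
  rw [hx, hfr] at h1
  set s := t ^ (Fintype.card F) with hs
  have hs0 : s ≠ 0 := pow_ne_zero _ h0
  rw [inv_pow, ← hs] at h1
  have : (s - t) * (s * t - 1) = 0 := by
    field_simp at h1
    linear_combination h1
  rcases mul_eq_zero.mp this with h | h
  · left; exact sub_eq_zero.mp h
  · right; rw [pow_succ, ← hs]; exact sub_eq_zero.mp h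

lemma mem_F (t : ACF) (h : t ^ (Fintype.card F) = t) : ∃ a : F, algebraMap F ACF a = t := by
  have h1 := FiniteField.X_pow_card_sub_X_natDegree_eq ACF (Fintype.one_lt_card (α := F))
  have h2 := FiniteField.X_pow_card_sub_X_ne_zero ACF (Fintype.one_lt_card (α := F))
  classical
  by_contra hne
  push Not at hne
  have hsub : insert t (Finset.univ.image (algebraMap F ACF)) ⊆
      (X ^ (Fintype.card F) - X : ACF[X]).roots.toFinset := by
    intro y hy
    rw [Multiset.mem_toFinset, mem_roots h2]
    rw [Finset.mem_insert, Finset.mem_image] at hy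
    rcases hy with rfl | ⟨a, -, rfl⟩
    · simp [h]
    · simp [← map_pow, FiniteField.pow_card]
  have h3 := Finset.card_le_card hsub
  rw [Finset.card_insert_of_notMem (by simpa using hne),
    Finset.card_image_of_injective _ (algebraMap F ACF).injective, Finset.card_univ] at h3
  have h4 := Multiset.toFinset_card_le (X ^ (Fintype.card F) - X : ACF[X]).roots
  have h5 := card_roots' (X ^ (Fintype.card F) - X : ACF[X])
  omega

/-- S = 0 when `l` is prime to `Q² - 1`. -/
lemma S_zero (hF : ringChar F ≠ 2) (k l : ℕ)
    (hkl : k * l ≡ 1 [MOD ((Fintype.card F) ^ 2 - 1)]) :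
    ∑ x : F, quadraticChar F ((dickson 1 (1 : F) l).eval x) = 0 := by
  have hQ := Fintype.one_lt_card (α := F)
  have hN : 0 < (Fintype.card F) ^ 2 - 1 := by
    have : 1 < (Fintype.card F) ^ 2 := by nlinarith
    omega
  have ht : ∀ x : F, torus F ((Fintype.card F) ^ 2 - 1) x := by
    intro x
    obtain ⟨t, h0, hx⟩ := exists_t x
    refine ⟨t, ?_, hx⟩
    have e : (Fintype.card F) ^ 2 - 1 = (Fintype.card F - 1) * (Fintype.card F + 1) := by
      rw [mul_comm, ← Nat.sq_sub_sq, one_pow]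
    rcases t_frob x t h0 hx with h | h
    · have : t ^ (Fintype.card F - 1) = 1 := by
        apply mul_right_cancel₀ h0
        rw [← pow_succ, Nat.sub_add_cancel hQ.le, h, one_mul]
      rw [e, pow_mul, this, one_pow]
    · rw [e, mul_comm, pow_mul, h, one_pow]
  have inj : Function.Bijective (fun x : F => (dickson 1 (1 : F) l).eval x) := by
    apply Finite.injective_iff_bijective.mp
    intro a b hab
    have h1 := torus_inv hN k l hkl a (ht a)
    have h2 := torus_inv hN k l hkl b (ht b)
    simp only at hab
    rw [← h1, hab, h2]
  rw [← quadraticChar_sum_zero hF]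
  exact Fintype.sum_bijective _ inj _ _ (fun _ => rfl)

lemma w_not_torus (x : F) (h : ¬ torus F (Fintype.card F + 1) x) :
    1 - quadraticChar F (x ^ 2 - 4) = 0 := by
  obtain ⟨t, h0, hx⟩ := exists_t x
  rcases t_frob x t h0 hx with h1 | h1
  · obtain ⟨a, rfl⟩ := mem_F t h1
    have ha : a ≠ 0 := by rintro rfl; simp at h0
    have hxa : x = a + a⁻¹ := by
      apply (algebraMap F ACF).injective
      rw [hx]; simp
    have e : x ^ 2 - 4 = (a - a⁻¹) ^ 2 := by
      rw [hxa]; field_simp; ring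
    have : a - a⁻¹ ≠ 0 := by
      intro hz
      apply h
      have haa : a * a = 1 := by
        have := sub_eq_zero.mp hz
        field_simp at this; linear_combination this
      refine ⟨algebraMap F ACF a, ?_, hx⟩
      rw [pow_succ, h1, ← map_mul, haa, map_one]
    rw [e, quadraticChar_sq_one' this]; norm_num
  · exact absurd ⟨t, h1, hx⟩ h

open Classical in
lemma w_torus (hF : ringChar F ≠ 2) (x : F) (t : ACF) (ht : t ^ (Fintype.card F + 1) = 1)
    (hx : algebraMap F ACF x = t + t⁻¹) :
    1 - quadraticChar F (x ^ 2 - 4) = if t ^ 2 = 1 then 1 else 2 := by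
  have h2 : (2 : F) ≠ 0 := Ring.two_ne_zero hF
  have h0 : t ≠ 0 := torus_ne (Nat.succ_pos _) ht
  have e : algebraMap F ACF (x ^ 2 - 4) = (t - t⁻¹) ^ 2 := by
    rw [map_sub, map_pow, hx, map_ofNat]; field_simp; ring
  split_ifs with h
  · have : x ^ 2 - 4 = 0 := by
      apply (algebraMap F ACF).injective
      rw [e, map_zero]
      have : t - t⁻¹ = 0 := by field_simp; linear_combination h
      rw [this]; simp
    rw [this]; simp
  · have : quadraticChar F (x ^ 2 - 4) = -1 := by
      rw [quadraticChar_neg_one_iff_not_isSquare]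
      rintro ⟨b, hb⟩
      rw [hb, map_mul] at e
      have h3 : algebraMap F ACF b = t - t⁻¹ ∨ algebraMap F ACF b = -(t - t⁻¹) := by
        apply sq_eq_sq_iff_eq_or_eq_neg.mp
        rw [sq, e]
      have h4 : ∃ a : F, algebraMap F ACF a = t := by
        have h2' : (2 : ACF) ≠ 0 := by
          have := (map_ne_zero (algebraMap F ACF)).mpr h2
          rwa [map_ofNat] at this
        rcases h3 with h3 | h3
        · refine ⟨(x + b) / 2, ?_⟩
          rw [map_div₀, map_add, hx, h3]
          rw [map_ofNat]
          field_simp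
          ring
        · refine ⟨(x - b) / 2, ?_⟩
          rw [map_div₀, map_sub, hx, h3]
          rw [map_ofNat]
          field_simp
          ring
      obtain ⟨a, rfl⟩ := h4
      apply h
      rw [pow_succ, ← map_pow, FiniteField.pow_card] at ht
      rw [sq, ht]
    rw [this]; norm_num

lemma S_formula (hF : ringChar F ≠ 2) (k l : ℕ) (hl : 0 < l)
    (hkl : k * l ≡ 1 [MOD (Fintype.card F + 1)]) :
    2 * ∑ x : F, quadraticChar F ((dickson 1 (1 : F) l).eval x) =
      ∑ t : F, quadraticChar F (t ^ l + (t ^ l)⁻¹) - ∑ t : F, quadraticChar F (t + t⁻¹) := by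
  classical
  have hN : 0 < Fintype.card F + 1 := Nat.succ_pos _
  have hkl' : l * k ≡ 1 [MOD (Fintype.card F + 1)] := by rwa [mul_comm]
  have A := sum_add_inv hF (fun x => quadraticChar F ((dickson 1 (1 : F) l).eval x))
  have B := sum_add_inv hF (fun x => quadraticChar F x)
  have A' : ∑ t : F, (if t = 0 then 0 else quadraticChar F ((dickson 1 (1 : F) l).eval (t + t⁻¹))) =
      ∑ t : F, quadraticChar F (t ^ l + (t ^ l)⁻¹) := by
    refine Finset.sum_congr rfl fun t _ => ?_
    split_ifs with h
    · simp [h, hl.ne']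
    · rw [dickson_one_one_eval_add_inv t t⁻¹ (mul_inv_cancel₀ h), inv_pow]
  have B' : ∑ t : F, (if t = 0 then 0 else quadraticChar F (t + t⁻¹)) =
      ∑ t : F, quadraticChar F (t + t⁻¹) := by
    refine Finset.sum_congr rfl fun t _ => ?_
    split_ifs with h
    · simp [h]
    · rfl
  have W : ∑ x : F, quadraticChar F ((dickson 1 (1 : F) l).eval x) * (1 - quadraticChar F (x ^ 2 - 4)) =
      ∑ x : F, quadraticChar F x * (1 - quadraticChar F (x ^ 2 - 4)) := by
    have r : ∀ g : F → ℤ, ∑ x : F, g x * (1 - quadraticChar F (x ^ 2 - 4)) =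
        ∑ x ∈ Finset.univ.filter (fun x => torus F (Fintype.card F + 1) x),
          g x * (1 - quadraticChar F (x ^ 2 - 4)) := by
      intro g
      rw [Finset.sum_filter]
      refine Finset.sum_congr rfl fun x _ => ?_
      split_ifs with h
      · rfl
      · rw [w_not_torus x h, mul_zero]
    rw [r, r]
    refine Finset.sum_bij' (fun x _ => (dickson 1 (1 : F) l).eval x)
      (fun x _ => (dickson 1 (1 : F) k).eval x) ?_ ?_ ?_ ?_ ?_
    · intro x hx
      simp only [Finset.mem_filter, Finset.mem_univ, true_and] at hx ⊢
      exact torus_maps hN l x hx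
    · intro x hx
      simp only [Finset.mem_filter, Finset.mem_univ, true_and] at hx ⊢
      exact torus_maps hN k x hx
    · intro x hx
      simp only [Finset.mem_filter, Finset.mem_univ, true_and] at hx
      exact torus_inv hN k l hkl x hx
    · intro x hx
      simp only [Finset.mem_filter, Finset.mem_univ, true_and] at hx
      exact torus_inv hN l k hkl' x hx
    · intro x hx
      simp only [Finset.mem_filter, Finset.mem_univ, true_and] at hx
      obtain ⟨t, ht, hx⟩ := hx
      congr 1
      have ht' : (t ^ l) ^ (Fintype.card F + 1) = 1 := by
        rw [← pow_mul, mul_comm, pow_mul, ht, one_pow]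
      rw [w_torus hF x t ht hx, w_torus hF _ (t ^ l) ht' (dick_map x t (torus_ne hN ht) hx l)]
      have : t ^ 2 = 1 ↔ (t ^ l) ^ 2 = 1 := by
        constructor
        · intro h
          rw [← pow_mul, mul_comm, pow_mul, h, one_pow]
        · intro h
          have e : (t ^ l) ^ k = t := by
            rw [← pow_mul]
            exact pow_of_modEq ht hkl'
          rw [← e, ← pow_mul, mul_comm, pow_mul, h, one_pow]
      simp only [this]
  rw [A'] at A
  rw [B'] at B
  have Z := quadraticChar_sum_zero hF
  rw [A, B]
  simp only [mul_sub, mul_add, mul_one, Finset.sum_sub_distrib, Finset.sum_add_distrib] at W ⊢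
  linarith
end part1
section part2
set_option linter.unusedSectionVars false
set_option linter.style.haveILetI false
variable {F : Type} [Field F] [Fintype F] [DecidableEq F]

lemma exists_addChar (p : ℕ) [hp : Fact p.Prime] [CharP F p] :
    ∃ ψ : AddChar F ℂ, ψ.IsPrimitive ∧ (∀ x, ψ (x ^ p) = ψ x) ∧ ∀ x, ψ x ^ p = 1 := by
  letI : Algebra (ZMod p) F := ZMod.algebra F p
  haveI : NeZero p := ⟨hp.1.ne_zero⟩
  have hp0 := ZMod.isPrimitive_stdAddChar p
  refine ⟨(ZMod.stdAddChar (N := p)).compAddMonoidHom (Algebra.trace (ZMod p) F).toAddMonoidHom,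
    ?_, ?_, ?_⟩
  · apply AddChar.IsPrimitive.of_ne_one
    obtain ⟨a, ha1⟩ := Algebra.trace_surjective (ZMod p) F 1
    have ha : Algebra.trace (ZMod p) F a ≠ 0 := by rw [ha1]; exact one_ne_zero
    rw [AddChar.ne_one_iff]
    exact ⟨a, fun hf => ha <| (hp0.zmod_char_eq_one_iff p <| Algebra.trace (ZMod p) F a).mp hf⟩
  · intro x
    have := Algebra.trace_eq_of_algEquiv (FiniteField.frobeniusAlgEquiv (ZMod p) F p) x
    simp only [FiniteField.frobeniusAlgEquiv_apply, ZMod.card] at this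
    simp [this]
  · intro x
    rw [← AddChar.map_nsmul_eq_pow]
    have : p • x = 0 := by simp
    rw [this, AddChar.map_zero_eq_one]

variable {p : ℕ} [hp : Fact p.Prime] [hc : CharP F p] {ψ : AddChar F ℂ}

lemma psi_pow (hfr : ∀ x, ψ (x ^ p) = ψ x) (j : ℕ) (x : F) : ψ (x ^ p ^ j) = ψ x := by
  induction j with
  | zero => simp
  | succ j ih => rw [pow_succ, pow_mul, hfr, ih]

lemma gauss_frob (hfr : ∀ x, ψ (x ^ p) = ψ x) (α : MulChar F ℂ) (j : ℕ) :
    gaussSum (α ^ (p ^ j)) ψ = gaussSum α ψ := by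
  unfold gaussSum
  have hb : Function.Bijective (fun x : F => x ^ p ^ j) :=
    Finite.injective_iff_bijective.mp (iterateFrobenius_inj F p j)
  refine Fintype.sum_bijective _ hb _ _ ?_
  intro x
  rw [MulChar.pow_apply' _ (pow_ne_zero _ hp.1.ne_zero), psi_pow hfr, map_pow]

/-- pure Gauss sums -/
lemma gauss_pure (hψ : ψ.IsPrimitive) (hfr : ∀ x, ψ (x ^ p) = ψ x) (hψp : ∀ x, ψ x ^ p = 1)
    (hp2 : p ≠ 2) (n : ℕ) (hn : Fintype.card F = (p ^ n) ^ 2)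
    (α : MulChar F ℂ) (hα1 : α ≠ 1) (hα : ∀ c : F, c ≠ 0 → c ^ p ^ n = c → α c = 1)
    (x0 : F) (hx00 : x0 ≠ 0) (hx0 : x0 ^ p ^ n = - x0) :
    gaussSum α ψ = (Finset.univ.filter (fun c : F => c ^ p ^ n = c)).card * α x0 := by
  set q := p ^ n with hq
  set V := Finset.univ.filter (fun c : F => c ^ q = c) with hV
  have hq0 : q ≠ 0 := pow_ne_zero _ hp.1.ne_zero
  have hodd : Odd p := hp.1.odd_of_ne_two hp2
  have hqodd : Odd q := hodd.pow
  have addq : ∀ a b : F, (a + b) ^ q = a ^ q + b ^ q := fun a b => add_pow_char_pow ..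
  have memV : ∀ c, c ∈ V ↔ c ^ q = c := fun c => by simp [hV]
  have hqq : ∀ x : F, (x ^ q) ^ q = x := by
    intro x
    rw [← pow_mul, ← sq, ← hn, FiniteField.pow_card]
  have sq1 : ∀ z : ℂ, z ^ p = 1 → z ^ 2 = 1 → z = 1 := by
    intro z h1 h2
    obtain ⟨k, hk⟩ := hodd
    rw [hk, pow_succ, pow_mul, h2, one_pow, one_mul] at h1
    exact h1
  have h0V : (0 : F) ∈ V := by rw [memV]; simp [hq0]
  have one_lt : 1 < V.card := by
    refine Finset.one_lt_card.mpr ⟨0, h0V, 1, by rw [memV]; simp, zero_ne_one⟩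
  -- inner sum
  have inner : ∀ x : F, ∑ c ∈ V, ψ (c * x) = if x ^ q = -x then (V.card : ℂ) else 0 := by
    intro x
    split_ifs with h
    · have : ∀ c ∈ V, ψ (c * x) = 1 := by
        intro c hc
        rw [memV] at hc
        apply sq1 _ (hψp _)
        have h1 : ψ (c * x) = ψ (-(c * x)) := by
          rw [← psi_pow hfr n (c * x), ← hq, mul_pow, hc, h]
          congr 1; ring
        rw [sq]
        nth_rewrite 1 [h1]
        rw [← AddChar.map_add_eq_mul]; simp
      rw [Finset.sum_congr rfl this]; simp
    · have hex : ∃ c ∈ V, ψ (c * x) ≠ 1 := by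
        by_contra hall
        push Not at hall
        set y := x + x ^ q with hy
        have hy0 : y ≠ 0 := fun hy0 => h (by linear_combination hy0)
        have hyV : y ^ q = y := by rw [hy, addq, hqq]; ring
        have h1 : ∀ c ∈ V, ψ (c * y) = 1 := by
          intro c hc
          have h2 := hall c hc
          have h3 : ψ (c * x ^ q) = 1 := by
            rw [memV] at hc
            rw [← psi_pow hfr n, ← hq, mul_pow, hc] at h2
            exact h2
          rw [hy, mul_add, AddChar.map_add_eq_mul, h2, h3, one_mul]
        have h2 : ∀ c ∈ V, ψ c = 1 := by
          intro c hc
          have : c = (c * y⁻¹) * y := by field_simp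
          rw [this]
          apply h1
          rw [memV] at hc ⊢
          rw [mul_pow, inv_pow, hc, hyV]
        have h3 : ∀ z, ψ z = 1 := by
          intro z
          apply sq1 _ (hψp _)
          have := h2 (z + z ^ q) (by rw [memV, addq, hqq]; ring)
          rw [AddChar.map_add_eq_mul, psi_pow hfr n, ← sq] at this
          exact this
        have := hψ (one_ne_zero (α := F))
        apply this
        ext z
        simp [h3]
      obtain ⟨c0, hc0, hne⟩ := hex
      have key : ψ (c0 * x) * ∑ c ∈ V, ψ (c * x) = ∑ c ∈ V, ψ (c * x) := by
        rw [Finset.mul_sum]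
        refine Finset.sum_bij' (fun c _ => c0 + c) (fun c _ => c - c0) ?_ ?_ ?_ ?_ ?_
        · intro c hc
          rw [memV] at *
          rw [addq, hc, hc0]
        · intro c hc
          rw [memV] at *
          rw [sub_eq_add_neg, addq, hqodd.neg_pow, hc, hc0]
        · intro c _; ring
        · intro c _; ring
        · intro c _
          rw [← AddChar.map_add_eq_mul]; congr 1; ring
      have : (ψ (c0 * x) - 1) * ∑ c ∈ V, ψ (c * x) = 0 := by
        rw [sub_mul, key]; ring
      rcases mul_eq_zero.mp this with h | h
      · exact absurd (sub_eq_zero.mp h) hne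
      · exact h
  -- double sum
  have D1 : ∑ c ∈ V, ∑ x : F, α x * ψ (c * x) = (V.card - 1 : ℂ) * gaussSum α ψ := by
    rw [← Finset.add_sum_erase _ _ h0V]
    have z : ∑ x : F, α x * ψ (0 * x) = 0 := by
      simp [MulChar.sum_eq_zero_of_ne_one hα1]
    rw [z, zero_add]
    have : ∀ c ∈ V.erase 0, ∑ x : F, α x * ψ (c * x) = gaussSum α ψ := by
      intro c hc
      rw [Finset.mem_erase, memV] at hc
      have hs := gaussSum_mulShift α ψ (Units.mk0 c hc.1)
      rw [Units.val_mk0, hα c hc.1 hc.2, one_mul] at hs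
      rw [← hs]; rfl
    rw [Finset.sum_congr rfl this, Finset.sum_const, Finset.card_erase_of_mem h0V, nsmul_eq_mul,
      Nat.cast_sub one_lt.le, Nat.cast_one]
  have D2 : ∑ c ∈ V, ∑ x : F, α x * ψ (c * x) = V.card * ((V.card - 1 : ℂ) * α x0) := by
    rw [Finset.sum_comm]
    have : ∀ x : F, ∑ c ∈ V, α x * ψ (c * x) = if x ^ q = -x then α x * V.card else 0 := by
      intro x
      rw [← Finset.mul_sum, inner]; split_ifs <;> simp
    rw [Finset.sum_congr rfl (fun x _ => this x), ← Finset.sum_filter]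
    have e : ∑ x ∈ Finset.univ.filter (fun x : F => x ^ q = -x), α x * (V.card : ℂ) =
        ∑ c ∈ V, α (c * x0) * (V.card : ℂ) := by
      refine Finset.sum_bij' (fun x _ => x * x0⁻¹) (fun c _ => c * x0) ?_ ?_ ?_ ?_ ?_
      · intro x hx
        rw [Finset.mem_filter] at hx
        rw [memV, mul_pow, inv_pow, hx.2, hx0, inv_neg]; ring
      · intro x hx
        rw [memV] at hx
        simp [mul_pow, hx, hx0]
      · intro x _; field_simp
      · intro x _; field_simp
      · intro x _; congr 2; field_simp
    rw [e, ← Finset.add_sum_erase _ _ h0V]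
    have : ∀ c ∈ V.erase 0, α (c * x0) * (V.card : ℂ) = α x0 * V.card := by
      intro c hc
      rw [Finset.mem_erase, memV] at hc
      rw [map_mul, hα c hc.1 hc.2, one_mul]
    rw [Finset.sum_congr rfl this, Finset.sum_const, Finset.card_erase_of_mem h0V, nsmul_eq_mul,
      Nat.cast_sub one_lt.le, Nat.cast_one]
    simp [MulChar.map_zero]; ring
  have hne : (V.card - 1 : ℂ) ≠ 0 := by
    rw [sub_ne_zero]; exact_mod_cast one_lt.ne'
  apply mul_left_cancel₀ hne
  rw [← D1, D2]; ring

/-- the complex quadratic character -/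
noncomputable def qc (F : Type) [Field F] [Fintype F] [DecidableEq F] : MulChar F ℂ :=
  (quadraticChar F).ringHomComp (Int.castRingHom ℂ)

lemma qc_apply (x : F) : qc F x = (quadraticChar F x : ℂ) := rfl

lemma qc_quad : (qc F).IsQuadratic := (quadraticChar_isQuadratic F).comp _

lemma qc_sq : (qc F) ^ 2 = 1 := qc_quad.sq_eq_one

lemma qc_gen (hF : ringChar F ≠ 2) {g : Fˣ} (hg : ∀ x, x ∈ Subgroup.zpowers g) :
    qc F g = -1 := by
  rw [qc_apply]
  have : quadraticChar F (g : F) = -1 := by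
    rw [quadraticChar_eq_neg_one_iff_not_one g.ne_zero]
    intro h
    apply quadraticChar_ne_one hF
    rw [MulChar.eq_iff hg, h, MulChar.one_apply_coe]
  rw [this]; simp

lemma qc_ne_one (hF : ringChar F ≠ 2) : qc F ≠ 1 := by
  obtain ⟨g, hg⟩ := IsCyclic.exists_generator (α := Fˣ)
  intro h
  have := qc_gen hF hg
  rw [h, MulChar.one_apply_coe] at this
  norm_num at this

lemma mulChar_triv (q : ℕ) (hq : 1 < q) (hn : Fintype.card F = q ^ 2) (α : MulChar F ℂ)
    (hα : α ^ (q + 1) = 1) (c : F) (hc0 : c ≠ 0) (hc : c ^ q = c) : α c = 1 := by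
  obtain ⟨g, hg⟩ := IsCyclic.exists_generator (α := Fˣ)
  obtain ⟨i, hi⟩ := (mem_powers_iff_mem_zpowers.mpr (hg (Units.mk0 c hc0)))
  have ho : orderOf g = q ^ 2 - 1 := by
    rw [orderOf_eq_card_of_forall_mem_zpowers hg, Nat.card_eq_fintype_card, Fintype.card_units, hn]
  have e : q ^ 2 - 1 = (q + 1) * (q - 1) := by
    rw [← Nat.sq_sub_sq, one_pow]
  have h1 : g ^ (i * (q - 1)) = 1 := by
    rw [pow_mul]
    simp only at hi
    rw [hi]
    ext
    simp
    apply mul_right_cancel₀ hc0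
    rw [← pow_succ, Nat.sub_add_cancel hq.le, hc, one_mul]
  have h2 := orderOf_dvd_of_pow_eq_one h1
  rw [ho, e] at h2
  have h3 : q + 1 ∣ i := Nat.dvd_of_mul_dvd_mul_right (by omega) h2
  obtain ⟨k, rfl⟩ := h3
  have : c = (g : F) ^ ((q + 1) * k) := by
    have := congrArg Units.val hi
    simpa using this.symm
  rw [this, map_pow, pow_mul, ← MulChar.pow_apply_coe, hα, MulChar.one_apply_coe, one_pow]

lemma gauss_val (hψ : ψ.IsPrimitive) (hfr : ∀ x, ψ (x ^ p) = ψ x) (hψp : ∀ x, ψ x ^ p = 1)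
    (hp2 : p ≠ 2) (n : ℕ) (hn0 : 0 < n) (hn : Fintype.card F = (p ^ n) ^ 2)
    {g : Fˣ} (hg : ∀ x, x ∈ Subgroup.zpowers g)
    (α : MulChar F ℂ) (hα1 : α ≠ 1) (hα : α ^ (p ^ n + 1) = 1) :
    gaussSum α ψ = (p ^ n : ℕ) * α g ^ ((p ^ n + 1) / 2) := by
  have hF : ringChar F ≠ 2 := by rwa [ringChar.eq F p]
  have hodd : Odd p := hp.1.odd_of_ne_two hp2
  have hqodd : Odd (p ^ n) := hodd.pow
  have hq1 : 1 < p ^ n := Nat.one_lt_pow hn0.ne' hp.1.one_lt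
  set q := p ^ n with hq
  have ho : orderOf g = q ^ 2 - 1 := by
    rw [orderOf_eq_card_of_forall_mem_zpowers hg, Nat.card_eq_fintype_card, Fintype.card_units, hn]
  obtain ⟨r, hr⟩ := hqodd
  have hr2 : (q + 1) / 2 = r + 1 := by omega
  set x0 : F := (g : F) ^ (r + 1) with hx0
  have hx00 : x0 ≠ 0 := pow_ne_zero _ g.ne_zero
  have hx01 : x0 ^ (q - 1) = -1 := by
    have h1 : (x0 ^ (q - 1)) ^ 2 = 1 := by
      rw [hx0, ← pow_mul, ← pow_mul]
      have : (r + 1) * (q - 1) * 2 = q ^ 2 - 1 := by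
        rw [hr]; simp
        have : (2 * r + 1) ^ 2 = 4 * r * r + 4 * r + 1 := by ring
        rw [this]; simp; ring
      rw [← mul_assoc, this, ← ho, ← Units.val_pow_eq_pow_val, pow_orderOf_eq_one]; rfl
    rcases sq_eq_one_iff.mp h1 with h | h
    · exfalso
      rw [hx0, ← pow_mul, ← Units.val_pow_eq_pow_val, Units.val_eq_one] at h
      have h2 := Nat.le_of_dvd (Nat.mul_pos (Nat.succ_pos _) (by omega))
        (orderOf_dvd_of_pow_eq_one h)
      rw [ho] at h2
      have : (2 * r + 1) ^ 2 = 4 * r * r + 4 * r + 1 := by ring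
      rw [hr, this] at h2
      simp at h2
      have hr0 : 0 < r := by omega
      nlinarith
    · exact h
  have hx02 : x0 ^ q = -x0 := by
    have : q = (q - 1) + 1 := by omega
    rw [this, pow_succ, hx01]; ring
  have P := fun (α : MulChar F ℂ) h1 h2 => gauss_pure hψ hfr hψp hp2 n hn α h1
    (mulChar_triv q hq1 hn α h2) x0 hx00 hx02
  have hV : (Finset.univ.filter (fun c : F => c ^ p ^ n = c)).card = q := by
    have h1 := P (qc F) (qc_ne_one hF) (by
      have : q + 1 = 2 * (r + 1) := by omega
      rw [this, pow_mul, qc_sq, one_pow])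
    have h2 := gaussSum_sq (qc_ne_one hF) qc_quad hψ
    have h3 : ∀ a : Fˣ, (qc F a) ^ 2 = 1 := by
      intro a
      rw [← MulChar.pow_apply_coe, qc_sq, MulChar.one_apply_coe]
    have h4 : qc F (-1) = 1 := by
      have hm : (-1 : F) = ((g ^ ((r + 1) * (q - 1)) : Fˣ) : F) := by
        rw [← hx01, hx0, ← pow_mul]; simp
      rw [hm]
      have : (r + 1) * (q - 1) = 2 * ((r + 1) * r) := by
        have : q - 1 = 2 * r := by omega
        rw [this]; ring
      rw [this, pow_mul, Units.val_pow_eq_pow_val, Units.val_pow_eq_pow_val, map_pow, map_pow, h3,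
        one_pow]
    have h5 := h3 (Units.mk0 x0 hx00)
    rw [Units.val_mk0] at h5
    rw [h1, h4, mul_pow, h5, hn] at h2
    have h6 : (Finset.univ.filter (fun c : F => c ^ p ^ n = c)).card ^ 2 = q ^ 2 := by
      have h7 : (((Finset.univ.filter (fun c : F => c ^ p ^ n = c)).card ^ 2 : ℕ) : ℂ) = ((q ^ 2 : ℕ) : ℂ) := by
        push_cast at h2 ⊢
        simpa using h2
      exact_mod_cast h7
    exact Nat.pow_left_injective (n := 2) (by norm_num) h6
  rw [P α hα1 hα, hV, hr2, hx0, map_pow]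

/-- the twisted sum in terms of Jacobi sums -/
lemma K_jacobi (hF : ringChar F ≠ 2) (hm1 : qc F (-1) = 1) (β α : MulChar F ℂ)
    (h : β * qc F = α ^ 2) :
    ∑ s : F, β s * qc F (s + s⁻¹) = α (-1) * (jacobiSum α (qc F) + jacobiSum (α * qc F) (qc F)) := by
  have e1 : ∀ s : F, β s * qc F (s + s⁻¹) = α (s ^ 2) * qc F (s ^ 2 + 1) := by
    intro s
    by_cases hs : s = 0
    · simp [hs, MulChar.map_zero]
    · have h1 : qc F (s + s⁻¹) = qc F (s ^ 2 + 1) * qc F s := by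
        rw [← map_mul]
        have : (s ^ 2 + 1) * s = (s + s⁻¹) * s ^ 2 := by field_simp
        rw [this, map_mul]
        have : qc F (s ^ 2) = 1 := by rw [qc_apply, quadraticChar_sq_one' hs]; simp
        rw [this, mul_one]
      have h2 : α (s ^ 2) = β s * qc F s := by
        rw [map_pow, ← MulChar.pow_apply' _ two_ne_zero, ← h, MulChar.mul_apply]
      rw [h1, h2]; ring
  have e2 : ∀ f : F → ℂ, ∑ s : F, f (s ^ 2) = ∑ u : F, (1 + qc F u) * f u := by
    intro f
    have : ∀ u : F, (1 + qc F u) = ∑ y : F, (if y ^ 2 = u then (1 : ℂ) else 0) := by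
      intro u
      have := congrArg (Int.cast : ℤ → ℂ) (sqrts_sum hF u)
      push_cast at this
      rw [this, qc_apply]; ring
    simp_rw [this, Finset.sum_mul]
    rw [Finset.sum_comm]
    simp
  rw [Finset.sum_congr rfl (fun s _ => e1 s), e2 (fun u => α u * qc F (u + 1))]
  unfold jacobiSum
  rw [← Finset.sum_add_distrib, Finset.mul_sum]
  refine Fintype.sum_equiv (Equiv.neg F) _ _ ?_
  intro u
  simp only [Equiv.neg_apply, MulChar.mul_apply]
  have a1 : ∀ γ : MulChar F ℂ, γ (-u) = γ (-1) * γ u := by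
    intro γ; rw [← map_mul]; simp
  have a2 : α (-1) * α (-1) = 1 := by rw [← map_mul]; simp
  rw [a1 α, a1 (qc F), hm1, sub_neg_eq_add, add_comm 1 u]
  linear_combination (-(α u * qc F (u + 1) * (1 + qc F u))) * a2

lemma K_val (hF : ringChar F ≠ 2) (hψ : ψ.IsPrimitive) (hm1 : qc F (-1) = 1) (β α : MulChar F ℂ)
    (h : β * qc F = α ^ 2) (h1 : β * qc F ≠ 1) (hα : gaussSum (α * qc F) ψ = gaussSum α ψ)
    (hαm : α (-1) = 1) :
    ∑ s : F, β s * qc F (s + s⁻¹) = 2 * gaussSum (qc F) ψ := by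
  rw [K_jacobi hF hm1 β α h, hαm, one_mul]
  have hα1 : α ≠ 1 := by rintro rfl; exact h1 (by rw [h, one_pow])
  have hα2 : α * qc F ≠ 1 := by
    intro h2
    apply h1
    rw [h]
    have : (α * qc F) ^ 2 = 1 := by rw [h2, one_pow]
    rwa [mul_pow, qc_sq, mul_one] at this
  have hα3 : α * qc F * qc F = α := by rw [mul_assoc, ← sq, qc_sq, mul_one]
  have hcard : (Fintype.card F : ℂ) ≠ 0 := by exact_mod_cast Fintype.card_ne_zero
  have hne := gaussSum_ne_zero_of_nontrivial hcard hα1 hψ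
  have j1 := jacobiSum_mul_nontrivial hα2 ψ
  have j2 := jacobiSum_mul_nontrivial (χ := α * qc F) (φ := qc F) (by rwa [hα3]) ψ
  rw [hα3, hα] at j2
  rw [hα] at j1
  have k1 := mul_left_cancel₀ hne j1
  have k2 := mul_left_cancel₀ hne j2
  rw [k1, k2]; ring

end part2
section part3
set_option linter.unusedSectionVars false
set_option linter.style.haveILetI false
variable {F : Type} [Field F] [Fintype F] [DecidableEq F]

lemma card_roots_pow (l : ℕ) (hl : l.Prime) (hd : l ∣ Fintype.card F - 1) (s : F) (hs : s ≠ 0) :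
    (Finset.univ.filter (fun t : F => t ^ l = s)).card = if ∃ t : F, t ^ l = s then l else 0 := by
  split_ifs with h
  · obtain ⟨t0, ht0⟩ := h
    have ht00 : t0 ≠ 0 := by
      rintro rfl
      rw [zero_pow hl.ne_zero] at ht0
      exact hs ht0.symm
    obtain ⟨g, hg⟩ := IsCyclic.exists_generator (α := Fˣ)
    have ho : orderOf g = Fintype.card F - 1 := by
      rw [orderOf_eq_card_of_forall_mem_zpowers hg, Nat.card_eq_fintype_card, Fintype.card_units]
    have hgp : IsPrimitiveRoot (g : F) (Fintype.card F - 1) := by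
      rw [IsPrimitiveRoot.coe_units_iff, ← ho]
      exact IsPrimitiveRoot.orderOf g
    obtain ⟨c, hc⟩ := hd
    have hprim := hgp.pow (Nat.sub_pos_of_lt (Fintype.one_lt_card (α := F)))
      (show Fintype.card F - 1 = c * l by rw [hc, mul_comm])
    refine Eq.trans ?_ hprim.card_nthRootsFinset
    refine Finset.card_bij' (fun t _ => t * t0⁻¹) (fun t _ => t * t0) ?_ ?_ ?_ ?_
    · intro t ht
      simp only [Finset.mem_filter, Finset.mem_univ, true_and] at ht
      rw [mem_nthRootsFinset hl.pos, mul_pow, inv_pow, ht, ht0, mul_inv_cancel₀ hs]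
    · intro t ht
      rw [mem_nthRootsFinset hl.pos] at ht
      simp [mul_pow, ht, ht0]
    · intro t _; field_simp
    · intro t _; field_simp
  · rw [Finset.card_eq_zero, Finset.filter_eq_empty_iff]
    intro t _ ht
    exact h ⟨t, ht⟩

lemma sum_pow_fiber (l : ℕ) (f : F → ℤ) :
    ∑ t : F, f (t ^ l) = ∑ s : F, f s * (Finset.univ.filter (fun t : F => t ^ l = s)).card := by
  simp_rw [Finset.card_filter]
  push_cast
  simp_rw [Finset.mul_sum]
  rw [Finset.sum_comm]
  simp

lemma dvd_sum_pow (l : ℕ) (hl : l.Prime) (hd : l ∣ Fintype.card F - 1) (f : F → ℤ) (h0 : f 0 = 0) :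
    (l : ℤ) ∣ ∑ t : F, f (t ^ l) := by
  rw [sum_pow_fiber]
  refine Finset.dvd_sum fun s _ => ?_
  by_cases hs : s = 0
  · simp [hs, h0]
  · rw [card_roots_pow l hl hd s hs]
    split_ifs <;> simp

lemma sum_char_pow (l : ℕ) (hl : l.Prime) (hd : l ∣ Fintype.card F - 1) (β : MulChar F ℂ)
    (hβ : orderOf β = l) (s : F) (hs : s ≠ 0) :
    ∑ j ∈ Finset.range l, (β ^ j) s =
      ((Finset.univ.filter (fun t : F => t ^ l = s)).card : ℂ) := by
  have e : ∀ j, (β ^ j) s = (β s) ^ j := by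
    intro j
    have := MulChar.pow_apply_coe β j (Units.mk0 s hs)
    simpa using this
  have hβl : β ^ l = 1 := by rw [← hβ, pow_orderOf_eq_one]
  have h1 : (β s) ^ l = 1 := by
    rw [← e, hβl]
    have := MulChar.one_apply_coe (R' := ℂ) (Units.mk0 s hs)
    simpa using this
  rw [Finset.sum_congr rfl (fun j _ => e j), card_roots_pow l hl hd s hs]
  by_cases h : β s = 1
  · have hex : ∃ t : F, t ^ l = s := by
      obtain ⟨g, hg⟩ := IsCyclic.exists_generator (α := Fˣ)
      obtain ⟨i, hi⟩ := (mem_powers_iff_mem_zpowers.mpr (hg (Units.mk0 s hs)))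
      have hs' : s = (g : F) ^ i := by
        have := congrArg Units.val hi
        simpa using this.symm
      have hg1 : β g ≠ 1 := by
        intro h2
        have : β = 1 := by rw [MulChar.eq_iff hg, h2, MulChar.one_apply_coe]
        rw [this, orderOf_one] at hβ
        exact hl.ne_one hβ.symm
      have hgl : (β g) ^ l = 1 := by
        rw [← MulChar.pow_apply_coe, hβl, MulChar.one_apply_coe]
      haveI : Fact l.Prime := ⟨hl⟩
      have ho : orderOf (β g) = l := orderOf_eq_prime hgl hg1
      rw [hs', map_pow] at h
      have := orderOf_dvd_of_pow_eq_one h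
      rw [ho] at this
      obtain ⟨k, rfl⟩ := this
      exact ⟨(g : F) ^ k, by rw [hs', ← pow_mul, mul_comm]⟩
    rw [if_pos hex, h]; simp
  · have hex : ¬ ∃ t : F, t ^ l = s := by
      rintro ⟨t, ht⟩
      apply h
      have ht0 : t ≠ 0 := by
        rintro rfl
        rw [zero_pow hl.ne_zero] at ht
        exact hs ht.symm
      have h3 := MulChar.pow_apply_coe β l (Units.mk0 t ht0)
      rw [hβl, MulChar.one_apply_coe, Units.val_mk0] at h3
      rw [← ht, map_pow, ← h3]
    rw [if_neg hex, geom_sum_eq h, h1]; simp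

lemma exists_eta (hF : ringChar F ≠ 2) (h4 : 4 ∣ Fintype.card F - 1) :
    ∃ η : MulChar F ℂ, η ^ 2 = qc F := by
  obtain ⟨η, hη⟩ := MulChar.exists_mulChar_orderOf F h4 (Complex.isPrimitiveRoot_exp 4 (by norm_num))
  refine ⟨η, ?_⟩
  obtain ⟨g, hg⟩ := IsCyclic.exists_generator (α := Fˣ)
  have h41 : η ^ 4 = 1 := by rw [← hη, pow_orderOf_eq_one]
  have h2 : η ^ 2 ≠ 1 := by
    intro h
    have := orderOf_dvd_of_pow_eq_one h
    rw [hη] at this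
    omega
  rw [MulChar.eq_iff hg, qc_gen hF hg]
  have h3 : ((η ^ 2) g) ^ 2 = 1 := by
    rw [← MulChar.pow_apply_coe, ← pow_mul, h41, MulChar.one_apply_coe]
  rcases sq_eq_one_iff.mp h3 with h | h
  · exfalso; apply h2
    rw [MulChar.eq_iff hg, h, MulChar.one_apply_coe]
  · exact h

variable {p : ℕ} [hp : Fact p.Prime] [hc : CharP F p]

lemma card_mod8 (q : ℕ) (hq : Odd q) (hn : Fintype.card F = q ^ 2) : ∃ k, Fintype.card F = 8 * k + 1 := by
  obtain ⟨r, rfl⟩ := hq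
  obtain ⟨k, hk⟩ := Nat.even_mul_succ_self r
  refine ⟨k, ?_⟩
  rw [hn]
  have : (2 * r + 1) ^ 2 = 4 * (r * (r + 1)) + 1 := by ring
  rw [this, hk]; ring

lemma neg_one_facts (hF : ringChar F ≠ 2) (hk : ∃ k, Fintype.card F = 8 * k + 1) :
    ∃ i : F, i * i = -1 ∧ qc F i = 1 := by
  obtain ⟨k, hk⟩ := hk
  have h1 : IsSquare (-1 : F) := by
    rw [FiniteField.isSquare_neg_one_iff]; omega
  obtain ⟨i, hi⟩ := h1
  refine ⟨i, hi.symm, ?_⟩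
  have hi0 : i ≠ 0 := by rintro rfl; simp at hi
  have : IsSquare i := by
    rw [FiniteField.isSquare_iff hF hi0]
    have : Fintype.card F / 2 = 4 * k := by omega
    rw [this, pow_mul]
    have : i ^ 4 = (i * i) ^ 2 := by ring
    rw [this, ← hi]; simp
  rw [qc_apply, (quadraticChar_one_iff_isSquare hi0).mpr this]; simp

lemma qc_neg_one (hF : ringChar F ≠ 2) (hk : ∃ k, Fintype.card F = 8 * k + 1) : qc F (-1) = 1 := by
  obtain ⟨i, hi, h⟩ := neg_one_facts hF hk
  rw [← hi, map_mul, h, one_mul]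

lemma gauss_qc {ψ : AddChar F ℂ} (hψ : ψ.IsPrimitive) (hfr : ∀ x, ψ (x ^ p) = ψ x)
    (hψp : ∀ x, ψ x ^ p = 1)
    (hp2 : p ≠ 2) (n : ℕ) (hn0 : 0 < n) (hn : Fintype.card F = (p ^ n) ^ 2) :
    gaussSum (qc F) ψ = (p ^ n : ℕ) * (-1) ^ ((p ^ n + 1) / 2) := by
  have hF : ringChar F ≠ 2 := by rwa [ringChar.eq F p]
  obtain ⟨g, hg⟩ := IsCyclic.exists_generator (α := Fˣ)
  have hodd : Odd (p ^ n) := (hp.1.odd_of_ne_two hp2).pow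
  rw [gauss_val hψ hfr hψp hp2 n hn0 hn hg (qc F) (qc_ne_one hF) ?_, qc_gen hF hg]
  obtain ⟨r, hr⟩ := hodd
  have : p ^ n + 1 = 2 * (r + 1) := by omega
  rw [this, pow_mul, qc_sq, one_pow]

/-- `T = ∑ χ(t + 1/t) = -2q` when `q ≡ 1 mod 4`. -/
lemma T_even (hp4 : p % 4 = 3) (n : ℕ) (hn0 : 0 < n) (hne : Even n)
    (hn : Fintype.card F = (p ^ n) ^ 2) :
    ∑ t : F, quadraticChar F (t + t⁻¹) = -2 * (p ^ n : ℕ) := by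
  have hp2 : p ≠ 2 := by rintro rfl; omega
  have hF : ringChar F ≠ 2 := by rwa [ringChar.eq F p]
  have hodd : Odd (p ^ n) := (hp.1.odd_of_ne_two hp2).pow
  have h8 := card_mod8 (p ^ n) hodd hn
  have hm1 := qc_neg_one hF h8
  obtain ⟨ψ, hψ, hfr, hψp⟩ := exists_addChar (F := F) p
  obtain ⟨η, hη⟩ := exists_eta hF (by obtain ⟨k, hk⟩ := h8; omega)
  have hη4 : η ^ 4 = 1 := by
    have : η ^ 4 = (η ^ 2) ^ 2 := by rw [← pow_mul]
    rw [this, hη, qc_sq]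
  have hηp : η ^ (p ^ 1) = η * qc F := by
    rw [pow_one, pow_eq_pow_mod p hη4, hp4, ← hη]
    exact pow_succ' η 2
  have hηm : η (-1) = 1 := by
    obtain ⟨i, hi, h⟩ := neg_one_facts hF h8
    rw [← hi, map_mul, ← sq, ← MulChar.pow_apply' _ two_ne_zero, hη, h]
  have K := K_val hF hψ hm1 1 η (by rw [one_mul, hη]) (by rw [one_mul]; exact qc_ne_one hF)
    (by rw [← hηp, gauss_frob hfr]) hηm
  rw [gauss_qc hψ hfr hψp hp2 n hn0 hn] at K
  have hq1 : p ^ n % 4 = 1 := by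
    obtain ⟨k, rfl⟩ := hne
    rw [← two_mul, pow_mul, Nat.pow_mod, Nat.pow_mod p 2 4, hp4]; simp
  have hsgn : ((-1 : ℂ)) ^ ((p ^ n + 1) / 2) = -1 := by
    apply Odd.neg_one_pow
    rw [Nat.odd_iff]; omega
  rw [hsgn] at K
  have e : ∑ s : F, (1 : MulChar F ℂ) s * qc F (s + s⁻¹) =
      ((∑ t : F, quadraticChar F (t + t⁻¹) : ℤ) : ℂ) := by
    push_cast
    refine Finset.sum_congr rfl fun s _ => ?_
    by_cases hs : s = 0
    · simp [hs, MulChar.map_zero]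
    · rw [MulChar.one_apply (isUnit_iff_ne_zero.mpr hs), one_mul, qc_apply]
  rw [e] at K
  have : ((∑ t : F, quadraticChar F (t + t⁻¹) : ℤ) : ℂ) = ((-2 * (p ^ n : ℕ) : ℤ) : ℂ) := by
    rw [K]; push_cast; ring
  exact_mod_cast this

lemma K_odd (hp4 : p % 4 = 3) (n : ℕ) (hno : Odd n)
    (hn : Fintype.card F = (p ^ n) ^ 2) (l : ℕ) (hl4 : l % 4 = 1)
    (hpm : p ^ n % l = 1 ∨ l ∣ p ^ n + 1) (β : MulChar F ℂ) (hβ : β ^ l = 1) :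
    ∑ s : F, β s * qc F (s + s⁻¹) = 2 * (p ^ n : ℕ) := by
  have hn0 : 0 < n := hno.pos
  have hp2 : p ≠ 2 := by rintro rfl; omega
  have hF : ringChar F ≠ 2 := by rwa [ringChar.eq F p]
  have hodd : Odd (p ^ n) := (hp.1.odd_of_ne_two hp2).pow
  have h8 := card_mod8 (p ^ n) hodd hn
  have hm1 := qc_neg_one hF h8
  obtain ⟨ψ, hψ, hfr, hψp⟩ := exists_addChar (F := F) p
  obtain ⟨η, hη⟩ := exists_eta hF (by obtain ⟨k, hk⟩ := h8; omega)
  have hη4 : η ^ 4 = 1 := by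
    have : η ^ 4 = (η ^ 2) ^ 2 := by rw [← pow_mul]
    rw [this, hη, qc_sq]
  have hq3 : p ^ n % 4 = 3 := by
    obtain ⟨k, rfl⟩ := hno
    rw [pow_succ, pow_mul, Nat.mul_mod, Nat.pow_mod, Nat.pow_mod p 2 4, hp4]; simp
  obtain ⟨a, ha⟩ : ∃ a, l = 2 * a + 1 := ⟨l / 2, by omega⟩
  set α := β ^ (a + 1) * η with hα
  have hα2 : β * qc F = α ^ 2 := by
    rw [hα, mul_pow, hη, ← pow_mul]
    have : (a + 1) * 2 = l + 1 := by omega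
    rw [this, pow_succ, hβ, one_mul]
  have h1 : β * qc F ≠ 1 := by
    intro h
    have : (β * qc F) ^ l = 1 := by rw [h, one_pow]
    rw [mul_pow, hβ, one_mul, ha, pow_succ, pow_mul, qc_sq, one_pow, one_mul] at this
    exact qc_ne_one hF this
  have hαm : α (-1) = 1 := by
    obtain ⟨i, hi, h⟩ := neg_one_facts hF h8
    have hi0 : i ≠ 0 := by rintro rfl; simp at hi
    have b4 : (β i) ^ 4 = 1 := by
      rw [← map_pow]
      have : i ^ 4 = (i * i) ^ 2 := by ring
      rw [this, hi]; simp
    have bl : (β i) ^ l = 1 := by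
      have h3 := MulChar.pow_apply_coe β l (Units.mk0 i hi0)
      rw [hβ, MulChar.one_apply_coe, Units.val_mk0] at h3
      exact h3.symm
    have b1 : β i = 1 := by
      rw [pow_eq_pow_mod l b4, hl4, pow_one] at bl
      exact bl
    rw [← hi, map_mul, ← sq, ← MulChar.pow_apply' _ two_ne_zero, ← hα2, MulChar.mul_apply, h, b1,
      one_mul]
  have hα1 : α ≠ 1 := by intro h; exact h1 (by rw [hα2, h, one_pow])
  have hsgn : ((-1 : ℂ)) ^ ((p ^ n + 1) / 2) = 1 := by
    apply Even.neg_one_pow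
    rw [Nat.even_iff]; omega
  have hg : gaussSum (α * qc F) ψ = gaussSum α ψ := by
    rcases hpm with h | h
    · have : α ^ (p ^ n) = α * qc F := by
        rw [hα, mul_pow, ← pow_mul, mul_comm (a + 1), pow_mul, pow_eq_pow_mod (p ^ n) hβ, h, pow_one,
          pow_eq_pow_mod (p ^ n) hη4, hq3, mul_assoc, ← hη]
        congr 1
        exact pow_succ' η 2
      rw [← this, gauss_frob hfr]
    · obtain ⟨g, hg⟩ := IsCyclic.exists_generator (α := Fˣ)
      have t1 : α ^ (p ^ n + 1) = 1 := by
        obtain ⟨c, hc⟩ := h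
        obtain ⟨d, hd⟩ : 4 ∣ p ^ n + 1 := by omega
        have e1 : (β ^ (a + 1)) ^ (p ^ n + 1) = 1 := by
          rw [← pow_mul, mul_comm, pow_mul, hc, pow_mul, hβ, one_pow, one_pow]
        have e2 : η ^ (p ^ n + 1) = 1 := by
          rw [hd, pow_mul, hη4, one_pow]
        rw [hα, mul_pow, e1, e2, one_mul]
      have t2 : (α * qc F) ^ (p ^ n + 1) = 1 := by
        obtain ⟨r, hr⟩ := hodd
        have : p ^ n + 1 = 2 * (r + 1) := by omega
        rw [mul_pow, t1, one_mul, this, pow_mul, qc_sq, one_pow]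
      have hα2' : α * qc F ≠ 1 := by
        intro h2
        apply h1
        rw [hα2]
        have : (α * qc F) ^ 2 = 1 := by rw [h2, one_pow]
        rwa [mul_pow, qc_sq, mul_one] at this
      rw [gauss_val hψ hfr hψp hp2 n hn0 hn hg α hα1 t1,
        gauss_val hψ hfr hψp hp2 n hn0 hn hg _ hα2' t2, MulChar.mul_apply, mul_pow, qc_gen hF hg,
        hsgn, mul_one]
  rw [K_val hF hψ hm1 β α hα2 h1 hg hαm, gauss_qc hψ hfr hψp hp2 n hn0 hn, hsgn, mul_one]

lemma S_odd (hp4 : p % 4 = 3) (n : ℕ) (hno : Odd n)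
    (hn : Fintype.card F = (p ^ n) ^ 2) (l : ℕ) (hl : l.Prime) (hl4 : l % 4 = 1)
    (hpm : p ^ n % l = 1 ∨ l ∣ p ^ n + 1) (hd : l ∣ Fintype.card F - 1) (k : ℕ)
    (hkl : k * l ≡ 1 [MOD (Fintype.card F + 1)]) :
    ∑ x : F, quadraticChar F ((dickson 1 (1 : F) l).eval x) = (l - 1) * (p ^ n : ℕ) := by
  have hp2 : p ≠ 2 := by rintro rfl; omega
  have hF : ringChar F ≠ 2 := by rwa [ringChar.eq F p]
  have A := S_formula hF k l hl.pos hkl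
  have K := K_odd (F := F) hp4 n hno hn l hl4 hpm
  obtain ⟨β, hβ⟩ := MulChar.exists_mulChar_orderOf F hd (Complex.isPrimitiveRoot_exp l hl.ne_zero)
  have hβl : β ^ l = 1 := by rw [← hβ, pow_orderOf_eq_one]
  have e : ((∑ t : F, quadraticChar F (t + t⁻¹) : ℤ) : ℂ) =
      ∑ s : F, (1 : MulChar F ℂ) s * qc F (s + s⁻¹) := by
    push_cast
    refine Finset.sum_congr rfl fun s _ => ?_
    by_cases hs : s = 0
    · simp [hs, MulChar.map_zero]
    · rw [MulChar.one_apply (isUnit_iff_ne_zero.mpr hs), one_mul, qc_apply]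
  rw [K 1 (one_pow _)] at e
  have e2 : ((∑ t : F, quadraticChar F (t ^ l + (t ^ l)⁻¹) : ℤ) : ℂ) = l * (2 * (p ^ n : ℕ)) := by
    rw [sum_pow_fiber l (fun s => quadraticChar F (s + s⁻¹))]
    push_cast
    have : ∀ s : F, ((quadraticChar F (s + s⁻¹) : ℤ) : ℂ) *
        ((Finset.univ.filter (fun t : F => t ^ l = s)).card : ℂ) =
        ∑ j ∈ Finset.range l, (β ^ j) s * qc F (s + s⁻¹) := by
      intro s
      by_cases hs : s = 0
      · simp [hs, MulChar.map_zero]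
      · rw [← Finset.sum_mul, sum_char_pow l hl hd β hβ s hs, qc_apply, mul_comm]
    rw [Finset.sum_congr rfl (fun s _ => this s), Finset.sum_comm]
    rw [Finset.sum_congr rfl (fun j _ => K (β ^ j) (by
      rw [← pow_mul, mul_comm, pow_mul, hβl, one_pow]))]
    simp
  have B := congrArg (Int.cast : ℤ → ℂ) A
  rw [Int.cast_mul, Int.cast_sub, e, e2] at B
  have C : ((∑ x : F, quadraticChar F ((dickson 1 (1 : F) l).eval x) : ℤ) : ℂ) =
      (((l - 1) * (p ^ n : ℕ) : ℤ) : ℂ) := by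
    push_cast at B ⊢
    linear_combination B / 2
  exact_mod_cast C

end part3

lemma exists_inv_mod (l N : ℕ) (hN : 1 < N) (h : Nat.Coprime l N) : ∃ k, k * l ≡ 1 [MOD N] := by
  obtain ⟨k, -, hk⟩ := Nat.exists_mul_mod_eq_one_of_coprime h hN
  exact ⟨k, by rw [mul_comm, Nat.ModEq, hk, Nat.mod_eq_of_lt hN]⟩

theorem statement4 (l p : ℕ) (hl : l.Prime) (hl4 : l % 4 = 1)
    (hp : p.Prime) (hp4 : p % 4 = 3) (hne : p ≠ l)
    (u : (ZMod l)ˣ) (hu : (u : ZMod l) = (p : ZMod l)) (m : ℕ)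
    (hm : m = orderOf (QuotientGroup.mk u :
      (ZMod l)ˣ ⧸ Subgroup.zpowers (-1 : (ZMod l)ˣ)))
    (hmodd : Odd m) (n : ℕ) (hn : 0 < n) :
    chebMaximal l (p ^ n) ↔ ∃ k, Odd k ∧ n = k * m := by
  classical
  haveI : Fact p.Prime := ⟨hp⟩
  haveI : Fact l.Prime := ⟨hl⟩
  have hp2 : p ≠ 2 := by rintro rfl; omega
  have hl2 := hl.two_le
  have key : ∀ N, m ∣ N ↔ ((p : ZMod l) ^ N = 1 ∨ (p : ZMod l) ^ N = -1) := by
    intro N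
    rw [hm, orderOf_dvd_iff_pow_eq_one, ← QuotientGroup.mk_pow, QuotientGroup.eq_one_iff,
      Subgroup.mem_zpowers_iff, ← hu]
    constructor
    · rintro ⟨k, hk⟩
      have hk' := congrArg Units.val hk
      rw [Units.val_pow_eq_pow_val] at hk'
      rw [← hk']
      rcases Int.even_or_odd k with h | h
      · left; rw [h.neg_one_zpow]; rfl
      · right; rw [h.neg_one_zpow]; rfl
    · rintro (h | h)
      · exact ⟨0, by ext; simp [h]⟩
      · exact ⟨1, by ext; simp [h]⟩
  have hq1 : 1 < p ^ n := Nat.one_lt_pow hn.ne' hp.one_lt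
  have hQ1 : 1 < (p ^ n) ^ 2 := Nat.one_lt_pow two_ne_zero hq1
  -- facts when m ∣ n
  have hdiv : m ∣ n → l ∣ (p ^ n) ^ 2 - 1 := by
    intro h
    rw [← ZMod.natCast_eq_zero_iff, Nat.cast_sub hQ1.le]
    push_cast
    rcases (key n).mp h with h | h <;> rw [h] <;> simp
  have hcop : m ∣ n → Nat.Coprime l ((p ^ n) ^ 2 + 1) := by
    intro h
    rw [hl.coprime_iff_not_dvd]
    intro h2
    have h3 := Nat.dvd_sub h2 (hdiv h)
    have : (p ^ n) ^ 2 + 1 - ((p ^ n) ^ 2 - 1) = 2 := by omega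
    rw [this] at h3
    have := Nat.le_of_dvd (by norm_num) h3
    omega
  have hpn0 : ∀ F : Type, ∀ [Field F] [Fintype F], Fintype.card F = (p ^ n) ^ 2 → CharP F p := by
    intro F _ _ hF
    exact charP_of_card_eq_prime_pow (f := n * 2) (by rw [hF, ← pow_mul])
  constructor
  · intro hmax
    let F := GaloisField p (n * 2)
    letI : Fintype F := Fintype.ofFinite F
    have hcard : Fintype.card F = (p ^ n) ^ 2 := by
      rw [← Nat.card_eq_fintype_card, GaloisField.card p (n * 2) (by omega), pow_mul]
    haveI := hpn0 F hcard
    have hF : ringChar F ≠ 2 := by rwa [ringChar.eq F p]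
    have h1 := cheb_count (F := F) hF l
    rw [hmax F hcard, hcard] at h1
    push_cast at h1
    rw [Nat.cast_sub hl.one_le] at h1
    have hS : ∑ x : F, quadraticChar F ((dickson 1 (1 : F) l).eval x) = (l - 1) * (p : ℤ) ^ n := by
      push_cast at h1
      linarith
    have hmn : m ∣ n := by
      by_contra hmn
      have hc : Nat.Coprime l ((Fintype.card F) ^ 2 - 1) := by
        rw [hl.coprime_iff_not_dvd, hcard]
        intro h2
        rw [← ZMod.natCast_eq_zero_iff, Nat.cast_sub (Nat.one_le_pow _ _ (by omega))] at h2
        push_cast at h2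
        have h3 := sq_eq_one_iff.mp (sub_eq_zero.mp h2)
        rw [← pow_mul] at h3
        have h4 := (key _).mpr h3
        exact hmn ((Nat.Coprime.dvd_of_dvd_mul_right (Nat.coprime_two_right.mpr hmodd)) h4)
      have hN : 1 < (Fintype.card F) ^ 2 - 1 := by
        rw [hcard]
        have : 2 ^ 2 ≤ ((p ^ n) ^ 2) ^ 2 := Nat.pow_le_pow_left hQ1 2
        omega
      obtain ⟨k, hk⟩ := exists_inv_mod l _ hN hc
      rw [S_zero hF k l hk] at hS
      have h5 : (0 : ℤ) < (l - 1) * (p : ℤ) ^ n := by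
        apply mul_pos
        · have : (2 : ℤ) ≤ l := by exact_mod_cast hl2
          linarith
        · have := hp.pos
          positivity
      omega
    obtain ⟨k, hk⟩ := hmn
    refine ⟨k, ?_, by rw [hk, mul_comm]⟩
    by_contra hke
    rw [Nat.not_odd_iff_even] at hke
    have hne' : Even n := by rw [hk]; exact hke.mul_left m
    have hmn : m ∣ n := ⟨k, hk⟩
    have hT := T_even (F := F) hp4 n hn hne' hcard
    obtain ⟨k', hk'⟩ := exists_inv_mod l (Fintype.card F + 1) (by rw [hcard]; omega)
      (by rw [hcard]; exact hcop hmn)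
    have hSf := S_formula hF k' l hl.pos hk'
    have hdv := dvd_sum_pow (F := F) l hl (by rw [hcard]; exact hdiv hmn)
      (fun s => quadraticChar F (s + s⁻¹)) (by simp)
    rw [hT, hS] at hSf
    push_cast at hSf
    have h6 : ∑ t : F, quadraticChar F (t ^ l + (t ^ l)⁻¹) = l * (2 * (p : ℤ) ^ n) - 4 * (p : ℤ) ^ n := by
      linarith
    rw [h6] at hdv
    have h7 : (l : ℤ) ∣ 4 * (p : ℤ) ^ n := (dvd_sub_right (Dvd.intro _ rfl)).mp hdv
    have h8 : l ∣ 4 * p ^ n := by exact_mod_cast h7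
    rcases hl.dvd_mul.mp h8 with h9 | h9
    · have : l ∣ 2 ^ 2 := by simpa using h9
      have := (Nat.prime_dvd_prime_iff_eq hl Nat.prime_two).mp (hl.dvd_of_dvd_pow this)
      omega
    · have := (Nat.prime_dvd_prime_iff_eq hl hp).mp (hl.dvd_of_dvd_pow h9)
      exact hne this.symm
  · rintro ⟨k, hko, hk⟩ F _ _ hcard
    have hmn : m ∣ n := ⟨k, by rw [hk, mul_comm]⟩
    have hno : Odd n := by rw [hk]; exact hko.mul hmodd
    haveI := hpn0 F hcard
    have hF : ringChar F ≠ 2 := by rwa [ringChar.eq F p]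
    have h1 := cheb_count (F := F) hF l
    obtain ⟨k', hk'⟩ := exists_inv_mod l (Fintype.card F + 1) (by rw [hcard]; omega)
      (by rw [hcard]; exact hcop hmn)
    have hpm : p ^ n % l = 1 ∨ l ∣ p ^ n + 1 := by
      rcases (key n).mp hmn with h | h
      · left
        have : ((p ^ n : ℕ) : ZMod l) = ((1 : ℕ) : ZMod l) := by push_cast; exact h
        rw [ZMod.natCast_eq_natCast_iff] at this
        rw [this, Nat.mod_eq_of_lt (by omega)]
      · right
        rw [← ZMod.natCast_eq_zero_iff]
        push_cast
        rw [h]; ring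
    rw [S_odd (F := F) hp4 n hno hcard l hl hl4 hpm (by rw [hcard]; exact hdiv hmn) k' hk',
      hcard] at h1
    zify
    rw [h1, Nat.cast_sub hl.one_le]
    push_cast
    ring
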